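/- For every real v > 0 and all real λ, ν, the series Σ_{k=0}^∞ e^(−(2k+1+λ+ν)·v)/(4π·sinh v) converges absolutely and e^(−(λ+ν)·v)/(16π²·sinh² v) = (1/(2π)) · Σ_{k=0}^∞ e^(−(2k+1+λ+ν)·v)/(4π·sinh v). Equivalently, the product of two three-dimensional AdS propagators G³_λ(cosh v)·G³_ν(cosh v), with G³_μ(cosh v) = e^(−μv)/(4π·sinh v), has the Källén–Lehmann series expansion (1/(2π))·Σ_{k=0}^∞ G³_{2k+1+λ+ν}(cosh v). -/

import Mathlib

open Real

/-- The geometric series `Σ_k e^{−(2k+1)v} = 1/(2 sinh v)` for `v > 0`. -/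
theorem hasSum_exp_neg_odd_mul {v : ℝ} (hv : 0 < v) :
    HasSum (fun k : ℕ => Real.exp (-(2 * (k : ℝ) + 1) * v)) (1 / (2 * Real.sinh v)) := by
  have hlt : Real.exp (-(2 * v)) < 1 := Real.exp_lt_one_iff.mpr (by linarith)
  have hgeom := (hasSum_geometric_of_lt_one (Real.exp_pos _).le hlt).mul_left (Real.exp (-v))
  have hterm (k : ℕ) : Real.exp (-(2 * (k : ℝ) + 1) * v) =
      Real.exp (-v) * Real.exp (-(2 * v)) ^ k := by
    rw [← Real.exp_nat_mul, ← Real.exp_add]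
    congr 1
    ring
  have hvalue : 1 / (2 * Real.sinh v) = Real.exp (-v) * (1 - Real.exp (-(2 * v)))⁻¹ := by
    have hsinh : 2 * Real.sinh v * Real.exp (-v) = 1 - Real.exp (-(2 * v)) := by
      have hone : Real.exp v * Real.exp (-v) = 1 := by rw [← Real.exp_add]; simp
      have hsq : Real.exp (-(2 * v)) = Real.exp (-v) * Real.exp (-v) := by
        rw [← Real.exp_add]
        congr 1
        ring
      rw [Real.sinh_eq, hsq]
      linear_combination hone
    have hpos : 0 < Real.sinh v := Real.sinh_pos_iff.mpr hv
    rw [← hsinh]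
    field_simp
  simpa only [hterm, hvalue] using hgeom

/-- Källén–Lehmann expansion of the AdS₃ bubble: with `G³_μ(cosh v) = e^{−μv}/(4π sinh v)`,
the product `G³_λ · G³_ν` expands as `(1/2π) Σ_k G³_{2k+1+λ+ν}`. -/
theorem KL_expansion_AdS3 (v lam nu : ℝ) (hv : 0 < v) :
    Summable (fun k : ℕ =>
      |Real.exp (-(2 * (k : ℝ) + 1 + lam + nu) * v) / (4 * Real.pi * Real.sinh v)|) ∧
    Real.exp (-(lam + nu) * v) / (16 * Real.pi ^ 2 * Real.sinh v ^ 2) =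
      (1 / (2 * Real.pi)) *
        ∑' k : ℕ, Real.exp (-(2 * (k : ℝ) + 1 + lam + nu) * v) / (4 * Real.pi * Real.sinh v) := by
  have hpos : 0 < Real.sinh v := Real.sinh_pos_iff.mpr hv
  have hsum : HasSum (fun k : ℕ =>
      Real.exp (-(2 * (k : ℝ) + 1 + lam + nu) * v) / (4 * Real.pi * Real.sinh v))
      (Real.exp (-(lam + nu) * v) * (1 / (2 * Real.sinh v)) / (4 * Real.pi * Real.sinh v)) := by
    have hterm (k : ℕ) : Real.exp (-(2 * (k : ℝ) + 1 + lam + nu) * v) =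
        Real.exp (-(lam + nu) * v) * Real.exp (-(2 * (k : ℝ) + 1) * v) := by
      rw [← Real.exp_add]
      congr 1
      ring
    simpa only [hterm] using
      ((hasSum_exp_neg_odd_mul hv).mul_left (Real.exp (-(lam + nu) * v))).div_const
        (4 * Real.pi * Real.sinh v)
  refine ⟨hsum.summable.abs, ?_⟩
  rw [hsum.tsum_eq]
  field_simp
  norm_num
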